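/- arXiv:2604.07150 — 4 statements merged into one kernel-verified Lean document; each statement's English description precedes it below -/
import Mathlib

section
/- Let n be a positive natural number, let Q and Q₀ be n×n complex Hermitian positive definite matrices, and let p, p₀ ∈ ℂⁿ. Then Re(pᴴ Q⁻¹ p) ≥ 2·Re(p₀ᴴ Q₀⁻¹ p) − Re(p₀ᴴ Q₀⁻¹ Q Q₀⁻¹ p₀); equivalently, −Re(pᴴ Q⁻¹ p) ≤ −2·Re(p₀ᴴ Q₀⁻¹ p) + Re(tr(Q₀⁻¹ p₀ p₀ᴴ Q₀⁻¹ Q)), with equality when p = p₀ and Q = Q₀. (This is the first-order tangent upper bound of the jointly concave function (p,Q) ↦ −pᴴQ⁻¹p used to construct the MM surrogate problem for the point-like-target waveform subproblem.) -/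
open Matrix
open scoped ComplexOrder

/-- A Hermitian matrix moves across the sesquilinear dot product. -/
theorem Matrix.IsHermitian.star_mulVec_dotProduct {ι R : Type*} [Fintype ι]
    [NonUnitalSemiring R] [StarRing R] {A : Matrix ι ι R} (hA : A.IsHermitian) (x y : ι → R) :
    star (A *ᵥ x) ⬝ᵥ y = star x ⬝ᵥ (A *ᵥ y) := by
  rw [star_mulVec, hA.eq, dotProduct_mulVec]

/-- Young's inequality for the quadratic forms of a positive definite matrix and its inverse. -/
theorem Matrix.PosDef.two_mul_re_dotProduct_le {ι : Type*} [Fintype ι] [DecidableEq ι]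
    {Q : Matrix ι ι ℂ} (hQ : Q.PosDef) (p w : ι → ℂ) :
    2 * (star w ⬝ᵥ p).re ≤ (star p ⬝ᵥ (Q⁻¹ *ᵥ p)).re + (star w ⬝ᵥ (Q *ᵥ w)).re := by
  have hdet : IsUnit Q.det := (isUnit_iff_isUnit_det Q).mp hQ.isUnit
  have hinv : Q⁻¹ *ᵥ (Q *ᵥ w) = w := by rw [mulVec_mulVec, nonsing_inv_mul Q hdet, one_mulVec]
  have hinv' : Q *ᵥ (Q⁻¹ *ᵥ p) = p := by rw [mulVec_mulVec, mul_nonsing_inv Q hdet, one_mulVec]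
  have hexp : star (p - Q *ᵥ w) ⬝ᵥ (Q⁻¹ *ᵥ (p - Q *ᵥ w)) =
      star p ⬝ᵥ (Q⁻¹ *ᵥ p) - star p ⬝ᵥ w - (star w ⬝ᵥ p - star w ⬝ᵥ (Q *ᵥ w)) := by
    rw [mulVec_sub, hinv, star_sub, sub_dotProduct, dotProduct_sub, dotProduct_sub,
      hQ.isHermitian.star_mulVec_dotProduct, hQ.isHermitian.star_mulVec_dotProduct, hinv']
  have hconj : (star p ⬝ᵥ w).re = (star w ⬝ᵥ p).re := by
    rw [star_dotProduct, Complex.star_def, Complex.conj_re]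
  have hnonneg := (Complex.le_def.mp
    (hQ.inv.posSemidef.dotProduct_mulVec_nonneg (p - Q *ᵥ w))).1
  rw [hexp] at hnonneg
  simp only [Complex.sub_re, Complex.zero_re, hconj] at hnonneg
  linarith

/-- First-order tangent upper bound of the jointly concave matrix-fractional function
`(p, Q) ↦ -pᴴ Q⁻¹ p` for Hermitian positive definite `Q`, used to construct the MM
surrogate problem for the point-like-target waveform subproblem. -/
theorem crb_mm_surrogate_bound_pointlike {n : ℕ} (hn : 0 < n)
    (Q Q₀ : Matrix (Fin n) (Fin n) ℂ) (hQ : Q.PosDef) (hQ₀ : Q₀.PosDef)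
    (p p₀ : Fin n → ℂ) :
    (star p ⬝ᵥ (Q⁻¹ *ᵥ p)).re ≥
      2 * (star p₀ ⬝ᵥ (Q₀⁻¹ *ᵥ p)).re - (star p₀ ⬝ᵥ ((Q₀⁻¹ * Q * Q₀⁻¹) *ᵥ p₀)).re ∧
    -(star p ⬝ᵥ (Q⁻¹ *ᵥ p)).re ≤
      -(2 * (star p₀ ⬝ᵥ (Q₀⁻¹ *ᵥ p)).re) +
        ((Q₀⁻¹ * vecMulVec p₀ (star p₀) * Q₀⁻¹ * Q).trace).re ∧
    (p = p₀ → Q = Q₀ →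
      (star p ⬝ᵥ (Q⁻¹ *ᵥ p)).re =
        2 * (star p₀ ⬝ᵥ (Q₀⁻¹ *ᵥ p)).re - (star p₀ ⬝ᵥ ((Q₀⁻¹ * Q * Q₀⁻¹) *ᵥ p₀)).re) := by
  have hbound := hQ.two_mul_re_dotProduct_le p (Q₀⁻¹ *ᵥ p₀)
  rw [hQ₀.inv.isHermitian.star_mulVec_dotProduct, hQ₀.inv.isHermitian.star_mulVec_dotProduct,
    mulVec_mulVec, mulVec_mulVec] at hbound
  have htrace : (Q₀⁻¹ * vecMulVec p₀ (star p₀) * Q₀⁻¹ * Q).trace =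
      star p₀ ⬝ᵥ ((Q₀⁻¹ * Q * Q₀⁻¹) *ᵥ p₀) := by
    rw [Matrix.mul_assoc, mul_vecMulVec, vecMulVec_mul, trace_vecMulVec, dotProduct_comm,
      ← dotProduct_mulVec, mulVec_mulVec]
  refine ⟨by linarith, by rw [htrace]; linarith, ?_⟩
  rintro rfl rfl
  rw [nonsing_inv_mul Q ((isUnit_iff_isUnit_det Q).mp hQ.isUnit), Matrix.one_mul]
  ring
end

section
/- Let n and k be positive natural numbers, let M and M₀ be n×n complex Hermitian positive definite matrices, and let L, L₀ be n×k complex matrices. Then Re(tr(Lᴴ M⁻¹ L)) ≥ 2·Re(tr(L₀ᴴ M₀⁻¹ L)) − Re(tr(M₀⁻¹ L₀ L₀ᴴ M₀⁻¹ M)); equivalently, −tr(LᴴM⁻¹L) ≤ −2·Re(tr(L₀ᴴM₀⁻¹L)) + Re(tr(M₀⁻¹L₀L₀ᴴM₀⁻¹M)), with equality when L = L₀ and M = M₀. (This is the first-order Taylor upper bound of the jointly concave matrix-fractional function −tr(LᴴM⁻¹L) used in the proof of Theorem 1 for the extended-target waveform subproblem.) -/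
open Matrix
open scoped ComplexOrder

/-- Young's inequality for the matrix-fractional function: `Lᴴ M⁻¹ L` dominates its affine
minorants in trace, as follows from expanding `(L - M W)ᴴ M⁻¹ (L - M W) ≥ 0`. -/
theorem Matrix.PosDef.two_mul_re_trace_sub_le {m n : Type*} [Fintype m] [Fintype n]
    [DecidableEq n] {M : Matrix n n ℂ} (hM : M.PosDef) (L W : Matrix n m ℂ) :
    2 * ((Wᴴ * L).trace).re - ((Wᴴ * M * W).trace).re ≤ ((Lᴴ * M⁻¹ * L).trace).re := by
  have hdet : IsUnit M.det := (isUnit_iff_isUnit_det M).mp hM.isUnit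
  have hexp : (L - M * W)ᴴ * M⁻¹ * (L - M * W) =
      Lᴴ * M⁻¹ * L - Lᴴ * W - Wᴴ * L + Wᴴ * M * W := by
    simp only [conjTranspose_sub, conjTranspose_mul, hM.isHermitian.eq, Matrix.sub_mul,
      Matrix.mul_sub, Matrix.mul_assoc, nonsing_inv_mul_cancel_left M _ hdet,
      mul_nonsing_inv_cancel_left M _ hdet]
    abel
  have hconj : ((Lᴴ * W).trace).re = ((Wᴴ * L).trace).re := by
    rw [← conjTranspose_conjTranspose W, ← conjTranspose_mul, trace_conjTranspose,
      conjTranspose_conjTranspose]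
    exact Complex.conj_re _
  have hnn := (Complex.le_def.mp
    (hM.inv.posSemidef.conjTranspose_mul_mul_same (L - M * W)).trace_nonneg).1
  rw [hexp] at hnn
  simp only [trace_add, trace_sub, Complex.add_re, Complex.sub_re, Complex.zero_re] at hnn
  linarith

/-- First-order Taylor upper bound of the jointly concave matrix-fractional function
`(L, M) ↦ -tr(Lᴴ M⁻¹ L)` for Hermitian positive definite `M`, used in the proof of
Theorem 1 for the extended-target waveform subproblem. -/
theorem crb_mm_surrogate_bound_extended {n k : ℕ} (hn : 0 < n) (hk : 0 < k)
    (M M₀ : Matrix (Fin n) (Fin n) ℂ) (hM : M.PosDef) (hM₀ : M₀.PosDef)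
    (L L₀ : Matrix (Fin n) (Fin k) ℂ) :
    ((Lᴴ * M⁻¹ * L).trace).re ≥
      2 * ((L₀ᴴ * M₀⁻¹ * L).trace).re - ((M₀⁻¹ * L₀ * L₀ᴴ * M₀⁻¹ * M).trace).re ∧
    -((Lᴴ * M⁻¹ * L).trace).re ≤
      -(2 * ((L₀ᴴ * M₀⁻¹ * L).trace).re) + ((M₀⁻¹ * L₀ * L₀ᴴ * M₀⁻¹ * M).trace).re ∧
    (L = L₀ → M = M₀ →
      ((Lᴴ * M⁻¹ * L).trace).re =
        2 * ((L₀ᴴ * M₀⁻¹ * L).trace).re - ((M₀⁻¹ * L₀ * L₀ᴴ * M₀⁻¹ * M).trace).re) := by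
  have hW : (M₀⁻¹ * L₀)ᴴ = L₀ᴴ * M₀⁻¹ := by
    rw [conjTranspose_mul, hM₀.inv.isHermitian.eq]
  have htr : (M₀⁻¹ * L₀ * L₀ᴴ * M₀⁻¹ * M).trace =
      (L₀ᴴ * M₀⁻¹ * M * (M₀⁻¹ * L₀)).trace := by
    rw [trace_mul_comm (L₀ᴴ * M₀⁻¹ * M)]
    simp only [Matrix.mul_assoc]
  have hbound := hM.two_mul_re_trace_sub_le L (M₀⁻¹ * L₀)
  rw [hW, ← htr] at hbound
  refine ⟨hbound, by linarith, ?_⟩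
  rintro rfl rfl
  have hdet : IsUnit M.det := (isUnit_iff_isUnit_det M).mp hM.isUnit
  rw [htr, nonsing_inv_mul_cancel_right M _ hdet, ← Matrix.mul_assoc]
  ring
end

section
/- Let n be a positive natural number. The matrix-fractional function is jointly convex: for all n×n complex Hermitian positive definite matrices Q₁, Q₂, all vectors p₁, p₂ ∈ ℂⁿ, and all t ∈ [0,1], the matrix t·Q₁ + (1−t)·Q₂ is Hermitian positive definite and Re((t·p₁ + (1−t)·p₂)ᴴ (t·Q₁ + (1−t)·Q₂)⁻¹ (t·p₁ + (1−t)·p₂)) ≤ t·Re(p₁ᴴ Q₁⁻¹ p₁) + (1−t)·Re(p₂ᴴ Q₂⁻¹ p₂). Equivalently, −pᴴQ⁻¹p is jointly concave in (p,Q) over ℂⁿ × {Hermitian positive definite matrices}. -/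
open Matrix
open scoped ComplexOrder

/-- The real part of `yᴴ p` is symmetric in `y` and `p`. -/
theorem re_star_dotProduct_comm {ι : Type*} [Fintype ι] (x y : ι → ℂ) :
    (star x ⬝ᵥ y).re = (star y ⬝ᵥ x).re := by
  rw [star_dotProduct, Complex.star_def, Complex.conj_re]

/-- Each `y` gives a lower bound for `pᴴ Q⁻¹ p` that is affine in `(p, Q)`. -/
theorem Matrix.PosDef.two_mul_re_sub_re_le {ι : Type*} [Fintype ι] [DecidableEq ι]
    {Q : Matrix ι ι ℂ} (hQ : Q.PosDef) (p y : ι → ℂ) :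
    2 * (star y ⬝ᵥ p).re - (star y ⬝ᵥ (Q *ᵥ y)).re ≤ (star p ⬝ᵥ (Q⁻¹ *ᵥ p)).re := by
  have hdet : IsUnit Q.det := (isUnit_iff_isUnit_det Q).mp hQ.isUnit
  have hp : Q *ᵥ (Q⁻¹ *ᵥ p) = p := by
    rw [mulVec_mulVec, mul_nonsing_inv Q hdet, one_mulVec]
  have hcross : star (Q⁻¹ *ᵥ p) ⬝ᵥ (Q *ᵥ y) = star p ⬝ᵥ y := by
    rw [dotProduct_mulVec]
    nth_rewrite 2 [← hQ.isHermitian.eq]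
    rw [← star_mulVec, hp]
  have h := (Complex.le_def.mp (hQ.posSemidef.dotProduct_mulVec_nonneg (y - Q⁻¹ *ᵥ p))).1
  rw [mulVec_sub, hp, star_sub, sub_dotProduct, dotProduct_sub, dotProduct_sub, hcross] at h
  simp only [Complex.zero_re, Complex.sub_re] at h
  rw [re_star_dotProduct_comm p y, re_star_dotProduct_comm (Q⁻¹ *ᵥ p) p] at h
  linarith

/-- The affine lower bound is attained at `y = Q⁻¹ p`. -/
theorem Matrix.PosDef.re_dotProduct_inv_mulVec {ι : Type*} [Fintype ι] [DecidableEq ι]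
    {Q : Matrix ι ι ℂ} (hQ : Q.PosDef) (p : ι → ℂ) :
    (star p ⬝ᵥ (Q⁻¹ *ᵥ p)).re = 2 * (star (Q⁻¹ *ᵥ p) ⬝ᵥ p).re -
      (star (Q⁻¹ *ᵥ p) ⬝ᵥ (Q *ᵥ (Q⁻¹ *ᵥ p))).re := by
  have hdet : IsUnit Q.det := (isUnit_iff_isUnit_det Q).mp hQ.isUnit
  rw [mulVec_mulVec, mul_nonsing_inv Q hdet, one_mulVec, re_star_dotProduct_comm p]
  ring

/-- Joint convexity of the matrix-fractional function `(p, Q) ↦ Re(pᴴ Q⁻¹ p)` over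
`ℂⁿ × {Hermitian positive definite matrices}`; equivalently, `-pᴴ Q⁻¹ p` is jointly
concave in `(p, Q)`. -/
theorem matrix_fractional_jointly_convex {n : ℕ} (hn : 0 < n)
    (Q₁ Q₂ : Matrix (Fin n) (Fin n) ℂ) (hQ₁ : Q₁.PosDef) (hQ₂ : Q₂.PosDef)
    (p₁ p₂ : Fin n → ℂ) (t : ℝ) (ht : t ∈ Set.Icc (0 : ℝ) 1) :
    (t • Q₁ + (1 - t) • Q₂).PosDef ∧
    (star (t • p₁ + (1 - t) • p₂) ⬝ᵥ
        ((t • Q₁ + (1 - t) • Q₂)⁻¹ *ᵥ (t • p₁ + (1 - t) • p₂))).re ≤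
      t * (star p₁ ⬝ᵥ (Q₁⁻¹ *ᵥ p₁)).re + (1 - t) * (star p₂ ⬝ᵥ (Q₂⁻¹ *ᵥ p₂)).re := by
  obtain ⟨ht0, ht1⟩ := ht
  have hQ : (t • Q₁ + (1 - t) • Q₂).PosDef := by
    rcases ht0.eq_or_lt with rfl | ht0
    · simpa using hQ₂
    · exact (hQ₁.smul ht0).add_posSemidef (hQ₂.posSemidef.smul (sub_nonneg.mpr ht1))
  refine ⟨hQ, ?_⟩
  rw [hQ.re_dotProduct_inv_mulVec]
  generalize (t • Q₁ + (1 - t) • Q₂)⁻¹ *ᵥ (t • p₁ + (1 - t) • p₂) = y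
  have h₁ := mul_le_mul_of_nonneg_left (hQ₁.two_mul_re_sub_re_le p₁ y) ht0
  have h₂ := mul_le_mul_of_nonneg_left (hQ₂.two_mul_re_sub_re_le p₂ y) (sub_nonneg.mpr ht1)
  simp only [add_mulVec, smul_mulVec, dotProduct_add, dotProduct_smul, Complex.add_re,
    Complex.smul_re, smul_eq_mul]
  linarith
end

section
/- Let X and Z be independent real random variables, each with the standard Gaussian distribution of mean 0 and variance 1, let ρ ∈ [−1, 1], and set Y = ρ·X + √(1−ρ²)·Z. Then E[sign(X)·sign(Y)] = (2/π)·arcsin(ρ). (This arcsine law yields the entries of the covariance matrix C_zz = (2/π)·arcsin(diag(C_rr)^{−1/2} C_rr diag(C_rr)^{−1/2}) of the one-bit quantized received signal.) -/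
open MeasureTheory ProbabilityTheory

theorem Real.measurable_sign : Measurable Real.sign :=
  Measurable.ite measurableSet_Iio measurable_const
    (Measurable.ite measurableSet_Ioi measurable_const measurable_const)

theorem Real.abs_sign_le_one (x : ℝ) : |Real.sign x| ≤ 1 := by
  rcases Real.sign_apply_eq x with h | h | h <;> simp [h]

theorem Real.sign_mul_of_pos {r : ℝ} (hr : 0 < r) (x : ℝ) : Real.sign (r * x) = Real.sign x := by
  rcases lt_trichotomy x 0 with h | rfl | h
  · rw [Real.sign_of_neg h, Real.sign_of_neg (mul_neg_of_pos_of_neg hr h)]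
  · simp
  · rw [Real.sign_of_pos h, Real.sign_of_pos (mul_pos hr h)]

/-- The integral of `sign (sin u)` between two points of `[-π, 0]` and `[0, π]`. -/
theorem integral_sign_sin {a b : ℝ} (ha : -Real.pi ≤ a) (ha0 : a ≤ 0) (hb0 : 0 ≤ b)
    (hb : b ≤ Real.pi) : ∫ u in a..b, Real.sign (Real.sin u) = a + b := by
  have hint (s t : ℝ) : IntervalIntegrable (fun u ↦ Real.sign (Real.sin u)) volume s t :=
    (intervalIntegrable_const (c := (1 : ℝ))).mono_fun
      (Real.measurable_sign.comp Real.measurable_sin).aestronglyMeasurable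
      (ae_of_all _ fun u ↦ by simpa using Real.abs_sign_le_one (Real.sin u))
  have hneg : ∫ u in a..0, Real.sign (Real.sin u) = ∫ _ in a..0, (-1 : ℝ) := by
    refine intervalIntegral.integral_congr_Ioo_of_le ha0 fun u hu ↦ ?_
    exact Real.sign_of_neg (Real.sin_neg_of_neg_of_neg_pi_lt hu.2 (ha.trans_lt hu.1))
  have hpos : ∫ u in (0 : ℝ)..b, Real.sign (Real.sin u) = ∫ _ in (0 : ℝ)..b, (1 : ℝ) := by
    refine intervalIntegral.integral_congr_Ioo_of_le hb0 fun u hu ↦ ?_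
    exact Real.sign_of_pos (Real.sin_pos_of_pos_of_lt_pi hu.1 (hu.2.trans_le hb))
  rw [← intervalIntegral.integral_add_adjacent_intervals (hint a 0) (hint 0 b), hneg, hpos]
  simp

/-- The angular part of the arcsine law. -/
theorem integral_sign_cos_mul_sign_sin_add {α : ℝ} (hα : -(Real.pi / 2) ≤ α)
    (hα' : α ≤ Real.pi / 2) :
    ∫ θ in -Real.pi..Real.pi, Real.sign (Real.cos θ) * Real.sign (Real.sin (θ + α)) = 4 * α := by
  set g : ℝ → ℝ := fun θ ↦ Real.sign (Real.cos θ) * Real.sign (Real.sin (θ + α)) with hg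
  have hper : Function.Periodic g Real.pi := fun θ ↦ by
    simp only [hg]
    rw [add_right_comm, Real.cos_add_pi, Real.sin_add_pi, Real.sign_neg, Real.sign_neg, neg_mul_neg]
  have hint (s t : ℝ) : IntervalIntegrable g volume s t := by
    refine (intervalIntegrable_const (c := (1 : ℝ))).mono_fun
      ((Real.measurable_sign.comp Real.measurable_cos).mul (Real.measurable_sign.comp
        (Real.measurable_sin.comp (measurable_add_const α)))).aestronglyMeasurable
      (ae_of_all _ fun u ↦ ?_)
    simpa [hg, abs_mul] using
      mul_le_one₀ (Real.abs_sign_le_one _) (abs_nonneg _) (Real.abs_sign_le_one _)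
  have htwo := hper.intervalIntegral_add_zsmul_eq 2 (-Real.pi) hint
  rw [hper.intervalIntegral_add_eq (-Real.pi) (-(Real.pi / 2))] at htwo
  have hhalf : ∫ θ in -(Real.pi / 2)..Real.pi / 2, g θ = 2 * α := by
    calc ∫ θ in -(Real.pi / 2)..Real.pi / 2, g θ
        = ∫ θ in -(Real.pi / 2)..Real.pi / 2, Real.sign (Real.sin (θ + α)) := by
          refine intervalIntegral.integral_congr_Ioo_of_le (by linarith [Real.pi_pos]) fun θ hθ ↦ ?_
          simp only [hg]
          rw [Real.sign_of_pos (Real.cos_pos_of_mem_Ioo hθ), one_mul]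
      _ = 2 * α := by
          rw [intervalIntegral.integral_comp_add_right (fun u ↦ Real.sign (Real.sin u)),
            integral_sign_sin (by linarith) (by linarith) (by linarith) (by linarith)]
          ring
  rw [show -Real.pi + (2 : ℤ) • Real.pi = Real.pi by simp; ring,
    show -(Real.pi / 2) + Real.pi = Real.pi / 2 by ring, hhalf] at htwo
  rw [htwo]
  simp
  ring

theorem integral_Ioi_mul_exp_neg_sq_div_two :
    ∫ r in Set.Ioi (0 : ℝ), r * Real.exp (-r ^ 2 / 2) = 1 := by
  have h := integral_rpow_mul_exp_neg_mul_rpow (p := 2) (q := 1) (b := 1 / 2)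
    (by norm_num) (by norm_num) (by norm_num)
  norm_num [Real.rpow_neg_one] at h
  rw [← h]
  congr 1 with r
  ring_nf

/-- Polar coordinates for a standard Gaussian pair and a function of the direction only. -/
theorem integral_gaussianReal_prod_of_homogeneous (F : ℝ × ℝ → ℝ)
    (hF : ∀ r > (0 : ℝ), ∀ p, F (r • p) = F p) :
    ∫ p, F p ∂(gaussianReal 0 1).prod (gaussianReal 0 1) =
      (2 * Real.pi)⁻¹ * ∫ θ in -Real.pi..Real.pi, F (Real.cos θ, Real.sin θ) := by
  have hpdf (x y : ℝ) : gaussianPDFReal 0 1 x * gaussianPDFReal 0 1 y =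
      (2 * Real.pi)⁻¹ * Real.exp (-(x ^ 2 + y ^ 2) / 2) := by
    have hsq : Real.sqrt (2 * Real.pi) * Real.sqrt (2 * Real.pi) = 2 * Real.pi :=
      Real.mul_self_sqrt (by positivity)
    simp only [gaussianPDFReal, NNReal.coe_one, mul_one, sub_zero]
    rw [mul_mul_mul_comm, ← mul_inv, hsq, ← Real.exp_add]
    ring_nf
  rw [gaussianReal_of_var_ne_zero 0 one_ne_zero, prod_withDensity
    (measurable_gaussianPDF 0 1) (measurable_gaussianPDF 0 1),
    integral_withDensity_eq_integral_toReal_smul (by fun_prop)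
      (ae_of_all _ fun p ↦ ENNReal.mul_lt_top gaussianPDF_lt_top gaussianPDF_lt_top)]
  simp only [ENNReal.toReal_mul, toReal_gaussianPDF, hpdf, smul_eq_mul]
  rw [← Measure.volume_eq_prod, ← integral_comp_polarCoord_symm,
    intervalIntegral.integral_of_le (by linarith [Real.pi_pos]), integral_Ioc_eq_integral_Ioo,
    ← one_mul (∫ θ in Set.Ioo _ _, _), ← integral_Ioi_mul_exp_neg_sq_div_two,
    ← setIntegral_prod_mul (fun r ↦ r * Real.exp (-r ^ 2 / 2))
      (fun θ ↦ F (Real.cos θ, Real.sin θ)), ← integral_const_mul, ← Measure.volume_eq_prod]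
  refine setIntegral_congr_fun polarCoord.open_target.measurableSet fun p hp ↦ ?_
  have hr : 0 < p.1 := hp.1
  have hnorm : (p.1 * Real.cos p.2) ^ 2 + (p.1 * Real.sin p.2) ^ 2 = p.1 ^ 2 := by
    linear_combination p.1 ^ 2 * Real.cos_sq_add_sin_sq p.2
  have hdir := hF p.1 hr (Real.cos p.2, Real.sin p.2)
  simp only [Prod.smul_mk, smul_eq_mul] at hdir
  simp only [polarCoord_symm_apply, hnorm, hdir, smul_eq_mul]
  ring

/-- The arcsine law for one-bit quantized jointly Gaussian variables: if `X, Z` are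
independent standard Gaussians and `Y = ρX + √(1−ρ²)Z`, then
`E[sign(X)·sign(Y)] = (2/π)·arcsin(ρ)`. This yields the entries of the covariance
matrix `C_zz` of the one-bit quantized received signal. -/
theorem one_bit_arcsine_law {Ω : Type*} [MeasurableSpace Ω]
    (μ : Measure Ω) [IsProbabilityMeasure μ]
    (X Z : Ω → ℝ) (hX : Measurable X) (hZ : Measurable Z)
    (hXZ : IndepFun X Z μ)
    (hXlaw : μ.map X = gaussianReal 0 1)
    (hZlaw : μ.map Z = gaussianReal 0 1)
    (ρ : ℝ) (hρ : ρ ∈ Set.Icc (-1 : ℝ) 1) :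
    ∫ ω, Real.sign (X ω) * Real.sign (ρ * X ω + Real.sqrt (1 - ρ ^ 2) * Z ω) ∂μ =
      (2 / Real.pi) * Real.arcsin ρ := by
  set F : ℝ × ℝ → ℝ := fun p ↦
    Real.sign p.1 * Real.sign (ρ * p.1 + Real.sqrt (1 - ρ ^ 2) * p.2) with hF
  have hFmeas : Measurable F :=
    (Real.measurable_sign.comp measurable_fst).mul (Real.measurable_sign.comp (by fun_prop))
  have hFhom (r : ℝ) (hr : r > 0) (p : ℝ × ℝ) : F (r • p) = F p := by
    simp only [hF, Prod.smul_fst, Prod.smul_snd, smul_eq_mul]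
    rw [show ρ * (r * p.1) + Real.sqrt (1 - ρ ^ 2) * (r * p.2) =
      r * (ρ * p.1 + Real.sqrt (1 - ρ ^ 2) * p.2) by ring,
      Real.sign_mul_of_pos hr, Real.sign_mul_of_pos hr]
  have hangle (θ : ℝ) : F (Real.cos θ, Real.sin θ) =
      Real.sign (Real.cos θ) * Real.sign (Real.sin (θ + Real.arcsin ρ)) := by
    simp only [hF]
    rw [Real.sin_add, Real.cos_arcsin, Real.sin_arcsin hρ.1 hρ.2]
    ring_nf
  have hlaw := (indepFun_iff_map_prod_eq_prod_map_map hX.aemeasurable hZ.aemeasurable).1 hXZ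
  rw [hXlaw, hZlaw] at hlaw
  calc ∫ ω, F (X ω, Z ω) ∂μ
      = ∫ p, F p ∂(gaussianReal 0 1).prod (gaussianReal 0 1) := by
        rw [← hlaw, integral_map (hX.prodMk hZ).aemeasurable hFmeas.aestronglyMeasurable]
    _ = (2 / Real.pi) * Real.arcsin ρ := by
        rw [integral_gaussianReal_prod_of_homogeneous F hFhom]
        simp only [hangle]
        rw [integral_sign_cos_mul_sign_sin_add (Real.neg_pi_div_two_le_arcsin ρ)
          (Real.arcsin_le_pi_div_two ρ)]
        field_simp
        norm_num
end
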